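/- Let k be a positive integer and let τ be a locally compact Hausdorff shift-continuous topology on B⁰(B_k). If the point (1,(0,0),1) is isolated in τ, then the adjoined zero 0* is isolated in τ as well. -/

import Mathlib

open Ordinal Set Topology

noncomputable section

/-- The `α`-bicyclic monoid: pairs of ordinals below `ω ^ α`. -/
def Bicyclic (α : Ordinal) : Type 1 :=
  {p : Ordinal × Ordinal // p.1 < ω ^ α ∧ p.2 < ω ^ α}

namespace Bicyclic

variable {α : Ordinal}

def mk (a b : Ordinal) (ha : a < ω ^ α) (hb : b < ω ^ α) : Bicyclic α :=
  ⟨(a, b), ha, hb⟩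

instance : Mul (Bicyclic α) :=
  ⟨fun x y =>
    if x.val.2 ≤ y.val.1 then
      ⟨(x.val.1 + (y.val.1 - x.val.2), y.val.2),
        (principal_add_omega0_opow α) x.2.1
          (lt_of_le_of_lt (Ordinal.sub_le_self _ _) y.2.1),
        y.2.2⟩
    else
      ⟨(x.val.1, y.val.2 + (x.val.2 - y.val.1)),
        x.2.1,
        (principal_add_omega0_opow α) y.2.2
          (lt_of_le_of_lt (Ordinal.sub_le_self _ _) x.2.2)⟩⟩

instance : One (Bicyclic α) :=
  ⟨⟨(0, 0), opow_pos α omega0_pos, opow_pos α omega0_pos⟩⟩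

end Bicyclic

/-- The Bruck extension of a semigroup `S`. -/
def Bruck (S : Type*) : Type _ := ℕ × S × ℕ

def Bruck.mk {S : Type*} (n : ℕ) (s : S) (m : ℕ) : Bruck S := (n, s, m)

instance {S : Type*} [Mul S] : Mul (Bruck S) :=
  ⟨fun x y =>
    if x.2.2 < y.1 then (x.1 + y.1 - x.2.2, y.2.1, y.2.2)
    else if y.1 < x.2.2 then (x.1, x.2.1, y.2.2 + x.2.2 - y.1)
    else (x.1, x.2.1 * y.2.1, y.2.2)⟩

/-- The Bruck extension of `S` with an adjoined (absorbing) zero `0*`. -/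
abbrev BruckZero (S : Type*) := WithZero (Bruck S)

/-- The box `[n,m]` in the Bruck extension with zero. -/
def box (S : Type*) (n m : ℕ) : Set (BruckZero S) :=
  {x | ∃ s : S, x = ↑(Bruck.mk n s m)}

/-- A topology on `X` is shift-continuous if all two-sided shifts `x ↦ a * x * b`
are continuous. -/
def ShiftContinuous (X : Type*) [Mul X] [TopologicalSpace X] : Prop :=
  ∀ a b : X, Continuous fun x => a * x * b

namespace Bicyclic

variable {α : Ordinal}

theorem mul_val_of_le {x y : Bicyclic α} (h : x.val.2 ≤ y.val.1) :
    (x * y).val = (x.val.1 + (y.val.1 - x.val.2), y.val.2) :=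
  congrArg Subtype.val (if_pos h)

theorem mul_val_of_lt {x y : Bicyclic α} (h : y.val.1 < x.val.2) :
    (x * y).val = (x.val.1, y.val.2 + (x.val.2 - y.val.1)) :=
  congrArg Subtype.val (if_neg h.not_ge)

theorem one_val : (1 : Bicyclic α).val = (0, 0) := rfl

instance : MulOneClass (Bicyclic α) where
  one_mul x := by
    apply Subtype.ext
    rw [mul_val_of_le (by simp [one_val])]
    simp [one_val]
  mul_one x := by
    apply Subtype.ext
    rcases eq_or_ne x.val.2 0 with h | h
    · rw [mul_val_of_le (by simp [one_val, h])]
      ext <;> simp [one_val, h]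
    · rw [mul_val_of_lt (by simpa [one_val] using pos_iff_ne_zero.2 h)]
      simp [one_val]

/-- The idempotent `(j, j)` is a right identity for `x` exactly when the second coordinate of `x`
is at least `j`. -/
theorem mul_mk_self_eq_iff {x : Bicyclic α} {j : Ordinal} (hj : j < ω ^ α) :
    x * mk j j hj hj = x ↔ j ≤ x.val.2 := by
  constructor
  · intro h
    by_contra! hlt
    have h2 := congrArg (fun y : Bicyclic α => y.val.2) h
    simp only [mul_val_of_le (x := x) (y := mk j j hj hj) hlt.le] at h2
    exact hlt.ne' h2
  · intro h
    apply Subtype.ext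
    rcases h.eq_or_lt with h | h
    · rw [mul_val_of_le (show x.val.2 ≤ (mk j j hj hj).val.1 from h.ge)]
      ext <;> simp [mk, h]
    · rw [mul_val_of_lt (show (mk j j hj hj).val.1 < x.val.2 from h)]
      ext
      · rfl
      · exact Ordinal.add_sub_cancel_of_le h.le

theorem le_mul_mk_snd (x : Bicyclic α) {j : Ordinal} (h0 : 0 < ω ^ α) (hj : j < ω ^ α) :
    j ≤ (x * mk 0 j h0 hj).val.2 := by
  rcases le_or_gt x.val.2 0 with h | h
  · rw [mul_val_of_le (show x.val.2 ≤ (mk 0 j h0 hj).val.1 from h)]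
    exact le_rfl
  · rw [mul_val_of_lt (show (mk 0 j h0 hj).val.1 < x.val.2 from h)]
    exact le_self_add

end Bicyclic

namespace BruckZero

variable {S : Type*}

/-- The nonzero element `(n, s, m)` of the Bruck extension with zero. -/
def elt (n : ℕ) (s : S) (m : ℕ) : BruckZero S := ↑(Bruck.mk n s m)

theorem elt_inj {n m n' m' : ℕ} {s s' : S} :
    elt n s m = elt n' s' m' ↔ n = n' ∧ s = s' ∧ m = m' := by
  rw [elt, elt, WithZero.coe_inj]
  exact Prod.mk_inj.trans (and_congr_right fun _ => Prod.mk_inj)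

theorem elt_ne_zero {n m : ℕ} {s : S} : elt n s m ≠ 0 := WithZero.coe_ne_zero

theorem eq_zero_or_elt (x : BruckZero S) : x = 0 ∨ ∃ n s m, x = elt n s m := by
  induction x using WithZero.recZeroCoe with
  | zero => exact Or.inl rfl
  | coe a => exact Or.inr ⟨a.1, a.2.1, a.2.2, rfl⟩

theorem elt_mul_elt [Mul S] (a b c d : ℕ) (s t : S) :
    elt a s b * elt c t d =
      if b < c then elt (a + c - b) t d
      else if c < b then elt a s (d + b - c) else elt a (s * t) d := by
  have h : Bruck.mk a s b * Bruck.mk c t d =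
      if b < c then Bruck.mk (a + c - b) t d
      else if c < b then Bruck.mk a s (d + b - c) else Bruck.mk a (s * t) d := rfl
  rw [elt, elt, ← WithZero.coe_mul, h]
  split_ifs <;> rfl

theorem box_eq_range (n m : ℕ) : box S n m = Set.range fun s : S => elt n s m := by
  ext x
  exact exists_congr fun s => eq_comm

/-- The union of the boxes `[n, m]` with `n, m < N`. -/
def lowerBoxes (S : Type*) (N : ℕ) : Set (BruckZero S) :=
  {x | ∃ n s m, n < N ∧ m < N ∧ x = elt n s m}

theorem elt_mem_lowerBoxes {n m N : ℕ} {s : S} :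
    elt n s m ∈ lowerBoxes S N ↔ n < N ∧ m < N := by
  constructor
  · rintro ⟨n', s', m', hn, hm, h⟩
    obtain ⟨rfl, -, rfl⟩ := elt_inj.1 h
    exact ⟨hn, hm⟩
  · rintro ⟨hn, hm⟩
    exact ⟨n, s, m, hn, hm, rfl⟩

variable [MulOneClass S]

theorem elt_one_mul (x : BruckZero S) : elt 0 1 0 * x = x := by
  rcases eq_zero_or_elt x with rfl | ⟨n, s, m, rfl⟩
  · exact mul_zero _
  · rw [elt_mul_elt]
    split_ifs with h h' <;> simp_all

theorem mul_elt_one (x : BruckZero S) : x * elt 0 1 0 = x := by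
  rcases eq_zero_or_elt x with rfl | ⟨n, s, m, rfl⟩
  · exact zero_mul _
  · rw [elt_mul_elt]
    split_ifs with h h' <;> simp_all

theorem elt_mul_idem_eq_iff {n m N : ℕ} {s : S} :
    elt n s m * elt N 1 N = elt n s m ↔ N ≤ m := by
  rw [elt_mul_elt]
  split_ifs with h h' <;> simp [elt_inj] <;> omega

theorem idem_mul_elt_eq_iff {n m N : ℕ} {s : S} :
    elt N 1 N * elt n s m = elt n s m ↔ N ≤ n := by
  rw [elt_mul_elt]
  split_ifs with h h' <;> simp [elt_inj] <;> omega

variable [TopologicalSpace (BruckZero S)]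

theorem continuous_mul_right (hτ : ShiftContinuous (BruckZero S)) (b : BruckZero S) :
    Continuous fun x => x * b := by
  simpa only [elt_one_mul] using hτ (elt 0 1 0) b

theorem continuous_mul_left (hτ : ShiftContinuous (BruckZero S)) (a : BruckZero S) :
    Continuous fun x => a * x := by
  simpa only [mul_elt_one] using hτ a (elt 0 1 0)

theorem isOpen_singleton_elt_succ (hτ : ShiftContinuous (BruckZero S))
    (hiso : IsOpen ({elt 1 1 1} : Set (BruckZero S))) (n m : ℕ) :
    IsOpen ({elt (n + 1) 1 (m + 1)} : Set (BruckZero S)) := by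
  convert hiso.preimage (hτ (elt 0 1 n) (elt m 1 0)) using 1
  ext x
  rw [mem_preimage, mem_singleton_iff, mem_singleton_iff]
  rcases eq_zero_or_elt x with rfl | ⟨p, s, q, rfl⟩
  · simp only [mul_zero, zero_mul, elt_ne_zero.symm]
  · rw [elt_mul_elt 0 n p q 1 s]
    split_ifs with h h'
    all_goals
      rw [elt_mul_elt]
      split_ifs with h1 h2 <;> simp only [elt_inj, mul_one] <;> grind

variable [T2Space (BruckZero S)]

theorem isOpen_lowerBoxes (hτ : ShiftContinuous (BruckZero S)) (N : ℕ) :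
    IsOpen (lowerBoxes S N) := by
  have h : lowerBoxes S N =
      {x | x * elt N 1 N = x}ᶜ ∩ {x | elt N 1 N * x = x}ᶜ := by
    ext x
    rcases eq_zero_or_elt x with rfl | ⟨n, s, m, rfl⟩
    · simp only [mem_inter_iff, mem_compl_iff, mem_ofPred_eq, zero_mul, not_true, false_and,
        iff_false]
      rintro ⟨n, s, m, -, -, h⟩
      exact elt_ne_zero h.symm
    · simp only [elt_mem_lowerBoxes, mem_inter_iff, mem_compl_iff, mem_ofPred_eq,
        elt_mul_idem_eq_iff, idem_mul_elt_eq_iff, not_le, and_comm]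
  rw [h]
  exact (isClosed_eq (continuous_mul_right hτ _) continuous_id).isOpen_compl.inter
    (isClosed_eq (continuous_mul_left hτ _) continuous_id).isOpen_compl

theorem isClosed_box (hτ : ShiftContinuous (BruckZero S))
    (hiso : IsOpen ({elt 1 1 1} : Set (BruckZero S))) (n m : ℕ) :
    IsClosed (box S n m) := by
  have h : box S n m =
      {x | x * elt (m + 1) 1 (m + 1) = elt (n + 1) 1 (m + 1)} ∩ {x | x * elt m 1 m = x} ∩
        {elt (n + 1) 1 (m + 1)}ᶜ := by
    ext x
    rw [box_eq_range]
    rcases eq_zero_or_elt x with rfl | ⟨p, s, q, rfl⟩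
    · simp [elt_ne_zero, elt_ne_zero.symm]
    · simp only [mem_range, mem_inter_iff, mem_ofPred_eq, mem_compl_iff, mem_singleton_iff,
        elt_mul_idem_eq_iff]
      rw [elt_mul_elt]
      split_ifs with h1 h2 <;> simp only [elt_inj, mul_one] <;> grind
  rw [h]
  exact ((isClosed_eq (continuous_mul_right hτ _) continuous_const).inter
    (isClosed_eq (continuous_mul_right hτ _) continuous_id)).inter
    (isOpen_singleton_elt_succ hτ hiso n m).isClosed_compl

theorem isClosed_lowerBoxes (hτ : ShiftContinuous (BruckZero S))
    (hiso : IsOpen ({elt 1 1 1} : Set (BruckZero S))) (N : ℕ) :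
    IsClosed (lowerBoxes S N) := by
  have h : lowerBoxes S N = ⋃ n ∈ Iio N, ⋃ m ∈ Iio N, box S n m := by
    ext x
    simp only [lowerBoxes, box_eq_range, mem_ofPred_eq, mem_iUnion, mem_Iio, mem_range]
    grind
  rw [h]
  exact (finite_Iio N).isClosed_biUnion fun n _ =>
    (finite_Iio N).isClosed_biUnion fun m _ => isClosed_box hτ hiso n m

/-- A continuous self-map fixing zero maps a compact neighbourhood of zero to itself, outside
finitely many boxes. -/
theorem exists_mapsTo_outside_lowerBoxes (hτ : ShiftContinuous (BruckZero S))
    {K : Set (BruckZero S)} (hK : IsCompact K) (hK0 : K ∈ 𝓝 0)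
    {f : BruckZero S → BruckZero S} (hf : Continuous f) (hf0 : f 0 = 0) :
    ∃ N, ∀ x ∈ K, x ∉ lowerBoxes S N → f x ∈ K := by
  have hW : IsOpen (f ⁻¹' interior K) := isOpen_interior.preimage hf
  obtain ⟨N, hN⟩ := (hK.diff hW).elim_directed_cover (lowerBoxes S) (isOpen_lowerBoxes hτ)
    (by
      rintro x ⟨-, hx⟩
      rcases eq_zero_or_elt x with rfl | ⟨n, s, m, rfl⟩
      · exact absurd (by rw [mem_preimage, hf0]; exact mem_interior_iff_mem_nhds.2 hK0) hx
      · exact mem_iUnion.2 ⟨n + m + 1, elt_mem_lowerBoxes.2 (by omega)⟩)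
    (directed_of_isDirected_le fun a b hab => by
      rintro x ⟨n, s, m, hn, hm, rfl⟩
      exact elt_mem_lowerBoxes.2 ⟨hn.trans_le hab, hm.trans_le hab⟩)
  refine ⟨N, fun x hx hxN => ?_⟩
  by_contra hfx
  exact hxN (hN ⟨hx, fun h => hfx (interior_subset h)⟩)

/-- If zero is not isolated in a locally compact shift-continuous topology with `(1, 1, 1)`
isolated, then `S` has a nonempty right ideal whose copy in some box is compact. -/
theorem exists_compact_right_ideal [LocallyCompactSpace (BruckZero S)]
    (hτ : ShiftContinuous (BruckZero S))
    (hiso : IsOpen ({elt 1 1 1} : Set (BruckZero S)))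
    (h0 : ¬ IsOpen ({0} : Set (BruckZero S))) :
    ∃ (N : ℕ) (A : Set S), A.Nonempty ∧ (∀ u ∈ A, ∀ t, u * t ∈ A) ∧
      IsCompact ((fun u => elt N u N) '' A) := by
  obtain ⟨K, hK, hK0⟩ := exists_compact_mem_nhds (0 : BruckZero S)
  obtain ⟨N₁, h₁⟩ := exists_mapsTo_outside_lowerBoxes hτ hK hK0
    (continuous_mul_right hτ (elt 0 1 1)) (zero_mul _)
  obtain ⟨N₂, h₂⟩ := exists_mapsTo_outside_lowerBoxes hτ hK hK0
    (continuous_mul_right hτ (elt 1 1 0)) (zero_mul _)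
  obtain ⟨N₃, h₃⟩ := exists_mapsTo_outside_lowerBoxes hτ hK hK0
    (continuous_mul_left hτ (elt 1 1 0)) (mul_zero _)
  obtain ⟨N₄, h₄⟩ := exists_mapsTo_outside_lowerBoxes hτ hK hK0
    (continuous_mul_left hτ (elt 0 1 1)) (mul_zero _)
  obtain ⟨N, hN⟩ : ∃ N, N = N₁ + N₂ + N₃ + N₄ := ⟨_, rfl⟩
  have hr (n m : ℕ) (u : S) (h : N ≤ n ∨ N ≤ m) : elt n u (m + 1) ∈ K ↔ elt n u m ∈ K := by
    constructor <;> intro hx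
    · convert h₂ _ hx (by rw [elt_mem_lowerBoxes]; omega) using 1
      rw [elt_mul_elt]
      split_ifs <;> simp only [elt_inj, mul_one] <;> grind
    · convert h₁ _ hx (by rw [elt_mem_lowerBoxes]; omega) using 1
      rw [elt_mul_elt]
      split_ifs <;> simp only [elt_inj, mul_one] <;> grind
  have hl (n m : ℕ) (u : S) (h : N ≤ n ∨ N ≤ m) : elt (n + 1) u m ∈ K ↔ elt n u m ∈ K := by
    constructor <;> intro hx
    · convert h₄ _ hx (by rw [elt_mem_lowerBoxes]; omega) using 1
      rw [elt_mul_elt]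
      split_ifs <;> simp only [elt_inj, one_mul] <;> grind
    · convert h₃ _ hx (by rw [elt_mem_lowerBoxes]; omega) using 1
      rw [elt_mul_elt]
      split_ifs <;> simp only [elt_inj, one_mul] <;> grind
  have hr0 (n m : ℕ) (u : S) (h : N ≤ n) : elt n u m ∈ K ↔ elt n u 0 ∈ K := by
    induction m with
    | zero => rfl
    | succ m ih => rw [hr n m u (Or.inl h), ih]
  have hl0 (n m : ℕ) (u : S) (h : N ≤ m) : elt n u m ∈ K ↔ elt 0 u m ∈ K := by
    induction n with
    | zero => rfl
    | succ n ih => rw [hl n m u (Or.inr h), ih]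
  have hNN (n m : ℕ) (u : S) (h : N ≤ n ∨ N ≤ m) : elt n u m ∈ K ↔ elt N u N ∈ K := by
    rcases h with h | h
    · rw [hr0 n m u h, ← hr0 n N u h, hl0 n N u le_rfl, hl0 N N u le_rfl]
    · rw [hl0 n m u h, ← hl0 N m u h, hr0 N m u le_rfl, hr0 N N u le_rfl]
  refine ⟨N, {u | elt N u N ∈ K}, ?_, ?_, ?_⟩
  · by_contra hA
    refine h0 (isOpen_singleton_iff_nhds_eq_pure _ |>.2 (le_antisymm ?_ (pure_le_nhds _)))
    rw [Filter.le_pure_iff]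
    have hL : (lowerBoxes S N)ᶜ ∈ 𝓝 (0 : BruckZero S) := by
      refine (isClosed_lowerBoxes hτ hiso N).isOpen_compl.mem_nhds ?_
      rintro ⟨n, s, m, -, -, h⟩
      exact elt_ne_zero h.symm
    filter_upwards [hK0, hL] with x hxK hxL
    rcases eq_zero_or_elt x with rfl | ⟨n, u, m, rfl⟩
    · rfl
    · rw [mem_compl_iff, elt_mem_lowerBoxes] at hxL
      exact absurd ⟨u, (hNN n m u (by omega)).1 hxK⟩ hA
  · intro u hu t
    obtain ⟨M, hM⟩ := exists_mapsTo_outside_lowerBoxes hτ hK hK0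
      (continuous_mul_right hτ (elt N t N)) (zero_mul _)
    have h := hM (elt (N + M) u N) ((hNN _ _ u (Or.inr le_rfl)).2 hu)
      (by rw [elt_mem_lowerBoxes]; omega)
    rw [elt_mul_elt, if_neg (lt_irrefl _), if_neg (lt_irrefl _)] at h
    exact (hNN _ _ _ (Or.inr le_rfl)).1 h
  · convert hK.inter_right (isClosed_box hτ hiso N N) using 1
    rw [box_eq_range]
    ext x
    constructor
    · rintro ⟨u, hu, rfl⟩
      exact ⟨hu, u, rfl⟩
    · rintro ⟨hx, u, rfl⟩
      exact ⟨u, hx, rfl⟩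

end BruckZero

/-- No nonempty right ideal of `B_α`, `α ≠ 0`, has compact image in a box. -/
theorem BruckZero.not_isCompact_right_ideal {α : Ordinal} (hα : α ≠ 0)
    [TopologicalSpace (BruckZero (Bicyclic α))] [T2Space (BruckZero (Bicyclic α))]
    (hτ : ShiftContinuous (BruckZero (Bicyclic α))) (N : ℕ) {A : Set (Bicyclic α)}
    (hA : A.Nonempty) (hAmul : ∀ u ∈ A, ∀ t, u * t ∈ A) :
    ¬ IsCompact ((fun u => elt N u N) '' A) := by
  intro hK
  have hpos : 0 < ω ^ α := opow_pos α omega0_pos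
  have hmul (u : Bicyclic α) (j : Ordinal) (hj : j < ω ^ α) :
      elt N u N * elt N (Bicyclic.mk j j hj hj) N = elt N u N ↔ j ≤ u.val.2 := by
    rw [elt_mul_elt, if_neg (lt_irrefl _), if_neg (lt_irrefl _), elt_inj,
      Bicyclic.mul_mk_self_eq_iff]
    simp
  let F : Iio (ω ^ α) → Set (BruckZero (Bicyclic α)) := fun j =>
    (fun u => elt N u N) '' A ∩ {x | x * elt N (Bicyclic.mk j j j.2 j.2) N = x}
  have hF (j : Iio (ω ^ α)) : IsClosed {x | x * elt N (Bicyclic.mk j j j.2 j.2) N = x} :=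
    isClosed_eq (continuous_mul_right hτ _) continuous_id
  have hanti : Antitone F := by
    rintro i j hij x ⟨⟨u, hu, rfl⟩, hx⟩
    exact ⟨⟨u, hu, rfl⟩, (hmul u i i.2).2 (le_trans hij ((hmul u j j.2).1 hx))⟩
  have : Nonempty (Iio (ω ^ α)) := ⟨⟨0, hpos⟩⟩
  obtain ⟨x, hx⟩ := IsCompact.nonempty_iInter_of_directed_nonempty_isCompact_isClosed F
    hanti.directed_ge
    (fun j => by
      obtain ⟨u, hu⟩ := hA
      exact ⟨_, ⟨_, hAmul u hu (Bicyclic.mk 0 j hpos j.2), rfl⟩,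
        (hmul _ j j.2).2 (u.le_mul_mk_snd hpos j.2)⟩)
    (fun j => hK.inter_right (hF j)) (fun j => hK.isClosed.inter (hF j))
  rw [mem_iInter] at hx
  obtain ⟨⟨u, -, rfl⟩, -⟩ := hx ⟨0, hpos⟩
  have hlt : u.val.2 + 1 < ω ^ α :=
    (isPrincipal_add_omega0_opow α) u.2.2 (one_lt_opow.2 ⟨one_lt_omega0, hα⟩)
  exact ((hmul u _ hlt).1 (hx ⟨_, hlt⟩).2).not_gt (lt_add_one _)

/-- For a positive integer `k` and a locally compact Hausdorff
shift-continuous topology on `B⁰(B_k)`: if `(1,(0,0),1)` is isolated, then the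
adjoined zero `0*` is isolated as well. -/
theorem zero_isolated_of_unit_isolated (k : ℕ) (hk : 0 < k)
    [TopologicalSpace (BruckZero (Bicyclic k))] [T2Space (BruckZero (Bicyclic k))]
    [LocallyCompactSpace (BruckZero (Bicyclic k))]
    (hτ : ShiftContinuous (BruckZero (Bicyclic k)))
    (hiso : IsOpen ({(↑(Bruck.mk 1 (1 : Bicyclic k) 1) : BruckZero (Bicyclic k))} :
      Set (BruckZero (Bicyclic k)))) :
    IsOpen ({0} : Set (BruckZero (Bicyclic k))) := by
  by_contra h0
  obtain ⟨N, A, hA, hAmul, hK⟩ := BruckZero.exists_compact_right_ideal hτ hiso h0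
  exact BruckZero.not_isCompact_right_ideal (by exact_mod_cast hk.ne') hτ N hA hAmul hK
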